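/- Let α, β, γ, A, B, C be positive real numbers, define p, q, r, L as in Eq. (3-2-L), set f(x,y) = (r + p·x + y)/(q·x + y), and let ȳ = (p+1+√((p+1)² + 4r(q+1)))/(2(q+1)). Then at least one of the following holds. (A) Every sequence (y_n)_{n≥-1} with y_{-1}, y_0 ∈ [L,∞) satisfying y_{n+1} = f(y_n, y_{n-1}) for all n ≥ 0 converges to ȳ. (B) There exist real numbers m*, M* with L < m* < M* such that: (i) f(x,y) ∈ [m*, M*] for all x, y ∈ [m*, M*]; (ii) for every solution (y_n)_{n≥-1} with y_{-1}, y_0 ∈ [L,∞) there is an N with y_n ∈ [m*, M*] for all n ≥ N; and (iii) f is coordinate-wise strictly monotonic on [m*, M*]², i.e., either x ↦ f(x,y) is strictly increasing on [m*, M*] for every y ∈ [m*, M*] or it is strictly decreasing on [m*, M*] for every y ∈ [m*, M*], and likewise y ↦ f(x,y) is strictly increasing on [m*, M*] for every x ∈ [m*, M*] or strictly decreasing on [m*, M*] for every x ∈ [m*, M*]. -/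

import Mathlib

open Filter Topology Set

/-- The function `(r + p x + y) / (q x + y)` of the recursion. -/
noncomputable def ratMap (p q r x y : ℝ) : ℝ := (r + p * x + y) / (q * x + y)

/-- The constraints satisfied by a possible pair (lower limit, upper limit) of a solution. -/
def LimitPair (p q r L I S : ℝ) : Prop :=
  L < I ∧ I ≤ S ∧ (∃ x ∈ Icc I S, ∃ y ∈ Icc I S, ratMap p q r x y = I) ∧
    ∃ x ∈ Icc I S, ∃ y ∈ Icc I S, ratMap p q r x y = S

/-- Coordinate-wise strict monotonicity of `ratMap p q r` on the square of `[m, M]`. -/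
def CoordStrict (p q r m M : ℝ) : Prop :=
  ((∀ y ∈ Icc m M, StrictMonoOn (fun x => ratMap p q r x y) (Icc m M)) ∨
    (∀ y ∈ Icc m M, StrictAntiOn (fun x => ratMap p q r x y) (Icc m M))) ∧
  ((∀ x ∈ Icc m M, StrictMonoOn (fun y => ratMap p q r x y) (Icc m M)) ∨
    (∀ x ∈ Icc m M, StrictAntiOn (fun y => ratMap p q r x y) (Icc m M)))

/-- The dichotomy, expressed through limit pairs. -/
def Dichotomy (p q r L : ℝ) : Prop :=
  (∀ I S, LimitPair p q r L I S → I = S) ∨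
    ∃ m M, L < m ∧ m < M ∧
      (∀ x ∈ Icc m M, ∀ y ∈ Icc m M, ratMap p q r x y ∈ Icc m M) ∧
      (∀ I S, LimitPair p q r L I S → m < I ∧ S < M) ∧ CoordStrict p q r m M

section Monotone

variable {p q r x x' y y' c : ℝ}

lemma le_ratMap_iff (hq : 0 < q) (hx : 0 < x) (hy : 0 < y) :
    c ≤ ratMap p q r x y ↔ c * (q * x + y) ≤ r + p * x + y :=
  le_div_iff₀ (by positivity)

lemma lt_ratMap_iff (hq : 0 < q) (hx : 0 < x) (hy : 0 < y) :
    c < ratMap p q r x y ↔ c * (q * x + y) < r + p * x + y :=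
  lt_div_iff₀ (by positivity)

lemma ratMap_le_iff (hq : 0 < q) (hx : 0 < x) (hy : 0 < y) :
    ratMap p q r x y ≤ c ↔ r + p * x + y ≤ c * (q * x + y) :=
  div_le_iff₀ (by positivity)

lemma ratMap_lt_iff (hq : 0 < q) (hx : 0 < x) (hy : 0 < y) :
    ratMap p q r x y < c ↔ r + p * x + y < c * (q * x + y) :=
  div_lt_iff₀ (by positivity)

lemma ratMap_sub_fst (hq : 0 < q) (hx : 0 < x) (hx' : 0 < x') (hy : 0 < y) :
    ratMap p q r x' y - ratMap p q r x y =
      (x' - x) * ((p - q) * y - q * r) / ((q * x' + y) * (q * x + y)) := by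
  have h1 : q * x + y ≠ 0 := by positivity
  have h2 : q * x' + y ≠ 0 := by positivity
  unfold ratMap
  field_simp
  ring

lemma ratMap_sub_snd (hq : 0 < q) (hx : 0 < x) (hy : 0 < y) (hy' : 0 < y') :
    ratMap p q r x y' - ratMap p q r x y =
      (y' - y) * ((q - p) * x - r) / ((q * x + y') * (q * x + y)) := by
  have h1 : q * x + y ≠ 0 := by positivity
  have h2 : q * x + y' ≠ 0 := by positivity
  unfold ratMap
  field_simp
  ring

lemma ratMap_mono_fst (hq : 0 < q) (hx : 0 < x) (hy : 0 < y) (h : x ≤ x')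
    (hs : q * r ≤ (p - q) * y) : ratMap p q r x y ≤ ratMap p q r x' y := by
  have hx' : 0 < x' := hx.trans_le h
  rw [← sub_nonneg, ratMap_sub_fst hq hx hx' hy]
  exact div_nonneg (mul_nonneg (sub_nonneg.2 h) (sub_nonneg.2 hs)) (by positivity)

lemma ratMap_anti_fst (hq : 0 < q) (hx : 0 < x) (hy : 0 < y) (h : x ≤ x')
    (hs : (p - q) * y ≤ q * r) : ratMap p q r x' y ≤ ratMap p q r x y := by
  have hx' : 0 < x' := hx.trans_le h
  rw [← sub_nonpos, ratMap_sub_fst hq hx hx' hy]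
  exact div_nonpos_of_nonpos_of_nonneg
    (mul_nonpos_of_nonneg_of_nonpos (sub_nonneg.2 h) (sub_nonpos.2 hs)) (by positivity)

lemma ratMap_mono_snd (hq : 0 < q) (hx : 0 < x) (hy : 0 < y) (h : y ≤ y')
    (hs : r ≤ (q - p) * x) : ratMap p q r x y ≤ ratMap p q r x y' := by
  have hy' : 0 < y' := hy.trans_le h
  rw [← sub_nonneg, ratMap_sub_snd hq hx hy hy']
  exact div_nonneg (mul_nonneg (sub_nonneg.2 h) (sub_nonneg.2 hs)) (by positivity)

lemma ratMap_anti_snd (hq : 0 < q) (hx : 0 < x) (hy : 0 < y) (h : y ≤ y')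
    (hs : (q - p) * x ≤ r) : ratMap p q r x y' ≤ ratMap p q r x y := by
  have hy' : 0 < y' := hy.trans_le h
  rw [← sub_nonpos, ratMap_sub_snd hq hx hy hy']
  exact div_nonpos_of_nonpos_of_nonneg
    (mul_nonpos_of_nonneg_of_nonpos (sub_nonneg.2 h) (sub_nonpos.2 hs)) (by positivity)

variable {m M : ℝ}

lemma strictMonoOn_ratMap_fst (hq : 0 < q) (hm : 0 < m) (hy : 0 < y)
    (hs : q * r < (p - q) * y) : StrictMonoOn (fun x => ratMap p q r x y) (Icc m M) := by
  intro a ha b hb hab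
  have ha' : 0 < a := hm.trans_le ha.1
  have hb' : 0 < b := hm.trans_le hb.1
  change ratMap p q r a y < ratMap p q r b y
  rw [← sub_pos, ratMap_sub_fst hq ha' hb' hy]
  exact div_pos (mul_pos (sub_pos.2 hab) (sub_pos.2 hs)) (by positivity)

lemma strictAntiOn_ratMap_fst (hq : 0 < q) (hm : 0 < m) (hy : 0 < y)
    (hs : (p - q) * y < q * r) : StrictAntiOn (fun x => ratMap p q r x y) (Icc m M) := by
  intro a ha b hb hab
  have ha' : 0 < a := hm.trans_le ha.1
  have hb' : 0 < b := hm.trans_le hb.1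
  change ratMap p q r b y < ratMap p q r a y
  rw [← sub_neg, ratMap_sub_fst hq ha' hb' hy]
  exact div_neg_of_neg_of_pos
    (mul_neg_of_pos_of_neg (sub_pos.2 hab) (sub_neg.2 hs)) (by positivity)

lemma strictMonoOn_ratMap_snd (hq : 0 < q) (hm : 0 < m) (hx : 0 < x)
    (hs : r < (q - p) * x) : StrictMonoOn (fun y => ratMap p q r x y) (Icc m M) := by
  intro a ha b hb hab
  have ha' : 0 < a := hm.trans_le ha.1
  have hb' : 0 < b := hm.trans_le hb.1
  change ratMap p q r x a < ratMap p q r x b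
  rw [← sub_pos, ratMap_sub_snd hq hx ha' hb']
  exact div_pos (mul_pos (sub_pos.2 hab) (sub_pos.2 hs)) (by positivity)

lemma strictAntiOn_ratMap_snd (hq : 0 < q) (hm : 0 < m) (hx : 0 < x)
    (hs : (q - p) * x < r) : StrictAntiOn (fun y => ratMap p q r x y) (Icc m M) := by
  intro a ha b hb hab
  have ha' : 0 < a := hm.trans_le ha.1
  have hb' : 0 < b := hm.trans_le hb.1
  change ratMap p q r x b < ratMap p q r x a
  rw [← sub_neg, ratMap_sub_snd hq hx ha' hb']
  exact div_neg_of_neg_of_pos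
    (mul_neg_of_pos_of_neg (sub_pos.2 hab) (sub_neg.2 hs)) (by positivity)

end Monotone

section Dynamics

variable {p q r L : ℝ}

lemma exists_preimage_of_mapClusterPt {a b : ℝ} (hq : 0 < q) (ha : 0 < a) {y : ℕ → ℝ}
    (hy : ∀ n, y n ∈ Icc a b) (hrec : ∀ n, y (n + 2) = ratMap p q r (y (n + 1)) (y n))
    {z : ℝ} (hz : MapClusterPt z atTop y) :
    ∃ u v, MapClusterPt u atTop y ∧ MapClusterPt v atTop y ∧ ratMap p q r u v = z := by
  obtain ⟨U, hU, hUz⟩ := mapClusterPt_iff_ultrafilter.1 hz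
  have hsub : Tendsto (fun n : ℕ => n - 2) U atTop := (tendsto_sub_atTop_nat 2).mono_left hU
  have key : ∀ φ : ℕ → ℕ, Tendsto φ U atTop →
      ∃ u ∈ Icc a b, Tendsto (fun n => y (φ n)) U (𝓝 u) ∧ MapClusterPt u atTop y := by
    intro φ hφ
    obtain ⟨u, hu, hlim⟩ := isCompact_Icc.ultrafilter_le_nhds (U.map fun n => y (φ n))
      (le_principal_iff.2 (Filter.mem_map.2 (univ_mem' fun n => hy (φ n))))
    have hlim' : Tendsto (fun n => y (φ n)) U (𝓝 u) := hlim
    exact ⟨u, hu, hlim', hlim'.mapClusterPt.of_comp hφ⟩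
  obtain ⟨v, hv, hvlim, hvc⟩ := key _ hsub
  obtain ⟨u, hu, hulim, huc⟩ := key (fun n => n - 2 + 1) (tendsto_atTop_mono (by simp) hsub)
  refine ⟨u, v, huc, hvc, ?_⟩
  have hpos : q * u + v ≠ 0 := by
    have := ha.trans_le hu.1
    have := ha.trans_le hv.1
    positivity
  have hlim : Tendsto (fun n => ratMap p q r (y (n - 2 + 1)) (y (n - 2))) U
      (𝓝 (ratMap p q r u v)) :=
    (((hulim.const_mul p).const_add r).add hvlim).div ((hulim.const_mul q).add hvlim) hpos
  refine tendsto_nhds_unique hlim (hUz.congr' ?_)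
  filter_upwards [hU (eventually_ge_atTop 2)] with n hn
  rw [← hrec, Nat.sub_add_cancel hn]

/-- A bounded positive solution is asymptotically confined to the interval spanned by its
smallest and largest limit points, both of which are values of the recursion there. -/
lemma exists_limit_bounds {a b : ℝ} (hq : 0 < q) (ha : 0 < a) {y : ℕ → ℝ}
    (hy : ∀ n, y n ∈ Icc a b) (hrec : ∀ n, y (n + 2) = ratMap p q r (y (n + 1)) (y n)) :
    ∃ I S, a ≤ I ∧ I ≤ S ∧
      (∃ u ∈ Icc I S, ∃ v ∈ Icc I S, ratMap p q r u v = I) ∧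
      (∃ u ∈ Icc I S, ∃ v ∈ Icc I S, ratMap p q r u v = S) ∧
      ∀ m M, m < I → S < M → ∀ᶠ n in atTop, y n ∈ Icc m M := by
  have hB : IsBoundedUnder (· ≤ ·) atTop y := isBoundedUnder_of ⟨b, fun n => (hy n).2⟩
  have hB' : IsBoundedUnder (· ≥ ·) atTop y := isBoundedUnder_of ⟨a, fun n => (hy n).1⟩
  have hS := isGreatest_mapClusterPt_limsup hB'.isCoboundedUnder_le hB
  have hI := isLeast_mapClusterPt_liminf hB.isCoboundedUnder_ge hB'
  have hmem : ∀ z, MapClusterPt z atTop y → z ∈ Icc (liminf y atTop) (limsup y atTop) :=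
    fun z hz => ⟨hI.2 hz, hS.2 hz⟩
  refine ⟨liminf y atTop, limsup y atTop, ?_, hI.2 hS.1, ?_, ?_, ?_⟩
  · exact isClosed_Ici.mem_of_mapClusterPt hI.1 (Eventually.of_forall fun n => (hy n).1)
  · obtain ⟨u, v, hu, hv, h⟩ := exists_preimage_of_mapClusterPt hq ha hy hrec hI.1
    exact ⟨u, hmem u hu, v, hmem v hv, h⟩
  · obtain ⟨u, v, hu, hv, h⟩ := exists_preimage_of_mapClusterPt hq ha hy hrec hS.1
    exact ⟨u, hmem u hu, v, hmem v hv, h⟩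
  · intro m M hm hM
    filter_upwards [eventually_lt_of_lt_liminf hm hB', eventually_lt_of_limsup_lt hM hB]
      with n h1 h2
    exact ⟨h1.le, h2.le⟩

/-- Values of the map exceed `L` on `[L, ∞)`. -/
lemma lt_ratMap_of_le (hq : 0 < q) (hL0 : 0 < L) (hL1 : L < 1) (hp : L * q < p)
    (hr : (q + 1) * L ^ 2 < r + (p + 1) * L) {x y : ℝ} (hx : L ≤ x) (hy : L ≤ y) :
    L < ratMap p q r x y := by
  rw [lt_ratMap_iff hq (by linarith) (by linarith)]
  nlinarith [mul_nonneg (sub_nonneg.2 hp.le) (sub_nonneg.2 hx),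
    mul_nonneg (sub_nonneg.2 hL1.le) (sub_nonneg.2 hy)]

/-- Values of the map are uniformly bounded on `[L, ∞)`. -/
lemma ratMap_le_bound (hq : 0 < q) (hp : 0 < p) (hL0 : 0 < L) {x y : ℝ} (hx : L ≤ x)
    (hy : L ≤ y) : ratMap p q r x y ≤ 1 + p / q + |r| / L := by
  have hx0 : 0 < x := by linarith
  have hy0 : 0 < y := by linarith
  rw [ratMap_le_iff hq hx0 hy0]
  have h1 : |r| ≤ |r| / L * y := by
    rw [div_mul_eq_mul_div, le_div_iff₀ hL0]
    exact mul_le_mul_of_nonneg_left hy (abs_nonneg r)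
  have h2 : p / q * (q * x) = p * x := by field_simp
  have h3 : 0 ≤ q * x + p / q * y + |r| / L * (q * x) := by positivity
  nlinarith [le_abs_self r]

/-- Every solution starting in `[L, ∞)` has limit bounds forming a limit pair. -/
lemma exists_limitPair (hq : 0 < q) (hL0 : 0 < L) (hL1 : L < 1) (hp : L * q < p)
    (hr : (q + 1) * L ^ 2 < r + (p + 1) * L) {y : ℕ → ℝ} (h0 : L ≤ y 0) (h1 : L ≤ y 1)
    (hrec : ∀ n, y (n + 2) = ratMap p q r (y (n + 1)) (y n)) :
    ∃ I S, LimitPair p q r L I S ∧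
      ∀ m M, m < I → S < M → ∀ᶠ n in atTop, y n ∈ Icc m M := by
  have hp0 : 0 < p := (mul_pos hL0 hq).trans hp
  have hlow : ∀ n, L ≤ y n ∧ L ≤ y (n + 1) := by
    intro n
    induction n with
    | zero => exact ⟨h0, h1⟩
    | succ k ih => exact ⟨ih.2, hrec k ▸ (lt_ratMap_of_le hq hL0 hL1 hp hr ih.2 ih.1).le⟩
  have hup : ∀ n, y n ≤ max (max (y 0) (y 1)) (1 + p / q + |r| / L) := by
    rintro (_ | _ | n)
    · simp
    · simp
    · exact le_max_of_le_right
        (hrec n ▸ ratMap_le_bound hq hp0 hL0 (hlow n).2 (hlow n).1)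
  obtain ⟨I, S, hI, hIS, ⟨u, hu, v, hv, h⟩, hS, hev⟩ :=
    exists_limit_bounds hq hL0 (fun n => ⟨(hlow n).1, hup n⟩) hrec
  refine ⟨I, S, ⟨?_, hIS, ⟨u, hu, v, hv, h⟩, hS⟩, hev⟩
  rw [← h]
  exact lt_ratMap_of_le hq hL0 hL1 hp hr (hI.trans hu.1) (hI.trans hv.1)

/-- A limit pair consisting of one point is the equilibrium. -/
lemma LimitPair.eq_equilibrium (hq : 0 < q) (hL0 : 0 < L)
    (hr : (q + 1) * L ^ 2 < r + (p + 1) * L) {I : ℝ} (h : LimitPair p q r L I I) :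
    I = (p + 1 + √((p + 1) ^ 2 + 4 * r * (q + 1))) / (2 * (q + 1)) := by
  obtain ⟨hLI, -, ⟨u, hu, v, hv, h⟩, -⟩ := h
  rw [Icc_self, mem_singleton_iff] at hu hv
  subst hu hv
  have hv0 : 0 < v := hL0.trans hLI
  rw [ratMap, div_eq_iff (by positivity)] at h
  have hvert : p + 1 ≤ 2 * (q + 1) * v := by
    by_contra! hc
    nlinarith [mul_nonneg (sub_nonneg.2 hLI.le) (sub_nonneg.2 hc.le),
      mul_nonneg hq.le (sq_nonneg (v - L)), sq_nonneg (v - L)]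
  have hsq : (p + 1) ^ 2 + 4 * r * (q + 1) = (2 * (q + 1) * v - (p + 1)) ^ 2 := by
    linear_combination 4 * (q + 1) * h
  rw [hsq, Real.sqrt_sq (by linarith)]
  field_simp
  ring

end Dynamics

section Bounds

variable {p q r L I S c : ℝ}

lemma LimitPair.le_of_forall (h : LimitPair p q r L I S)
    (hc : ∀ x ∈ Icc I S, ∀ y ∈ Icc I S, c ≤ ratMap p q r x y) : c ≤ I := by
  obtain ⟨-, -, ⟨x, hx, y, hy, e⟩, -⟩ := h
  exact e ▸ hc x hx y hy

lemma LimitPair.lt_of_forall (h : LimitPair p q r L I S)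
    (hc : ∀ x ∈ Icc I S, ∀ y ∈ Icc I S, c < ratMap p q r x y) : c < I := by
  obtain ⟨-, -, ⟨x, hx, y, hy, e⟩, -⟩ := h
  exact e ▸ hc x hx y hy

lemma LimitPair.forall_le (h : LimitPair p q r L I S)
    (hc : ∀ x ∈ Icc I S, ∀ y ∈ Icc I S, ratMap p q r x y ≤ c) : S ≤ c := by
  obtain ⟨-, -, -, ⟨x, hx, y, hy, e⟩⟩ := h
  exact e ▸ hc x hx y hy

lemma LimitPair.forall_lt (h : LimitPair p q r L I S)
    (hc : ∀ x ∈ Icc I S, ∀ y ∈ Icc I S, ratMap p q r x y < c) : S < c := by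
  obtain ⟨-, -, -, ⟨x, hx, y, hy, e⟩⟩ := h
  exact e ▸ hc x hx y hy

end Bounds

section Cases

variable {q L : ℝ}

/-- The case `p = q`. -/
lemma dichotomy_of_eq {r : ℝ} (hq : 0 < q) (hL0 : 0 < L) (hL1 : L < 1)
    (hr : (q + 1) * L ^ 2 < r + (q + 1) * L) : Dichotomy q q r L := by
  rcases lt_trichotomy r 0 with h | h | h
  · -- increasing in both coordinates, below `1`
    right
    have hsy : ∀ y : ℝ, q * r < (q - q) * y := fun y => by nlinarith
    have hsx : ∀ x : ℝ, r < (q - q) * x := fun x => by linarith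
    have hlt : ∀ x y : ℝ, 0 < x → 0 < y → ratMap q q r x y < 1 := fun x y hx hy => by
      rw [ratMap_lt_iff hq hx hy]; linarith
    have hbig : L < ratMap q q r L L := by
      rw [lt_ratMap_iff hq hL0 hL0]; linarith
    obtain ⟨m, hm, hmc⟩ := exists_between hbig
    have hge : ∀ x y : ℝ, L ≤ x → L ≤ y → ratMap q q r L L ≤ ratMap q q r x y :=
      fun x y hx hy => (ratMap_mono_fst hq hL0 hL0 hx (hsy _).le).trans
        (ratMap_mono_snd hq (hL0.trans_le hx) hL0 hy (hsx _).le)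
    have hm0 : 0 < m := hL0.trans hm
    refine ⟨m, 1, hm, hmc.trans (hlt L L hL0 hL0), ?_, ?_, ?_, ?_⟩
    · intro x hx y hy
      exact ⟨hmc.le.trans (hge x y (hm.le.trans hx.1) (hm.le.trans hy.1)),
        (hlt x y (hm0.trans_le hx.1) (hm0.trans_le hy.1)).le⟩
    · intro I S hIS
      have hI := hIS.1
      exact ⟨hIS.lt_of_forall fun x hx y hy =>
          hmc.trans_le (hge x y (hI.le.trans hx.1) (hI.le.trans hy.1)),
        hIS.forall_lt fun x hx y hy =>
          hlt x y ((hL0.trans hI).trans_le hx.1) ((hL0.trans hI).trans_le hy.1)⟩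
    · exact Or.inl fun y hy => strictMonoOn_ratMap_fst hq hm0 (hm0.trans_le hy.1) (hsy y)
    · exact Or.inl fun x hx => strictMonoOn_ratMap_snd hq hm0 (hm0.trans_le hx.1) (hsx x)
  · left
    intro I S hIS
    have hone : ∀ x ∈ Icc I S, ∀ y ∈ Icc I S, ratMap q q r x y = 1 := fun x hx y hy => by
      have hx0 : 0 < x := (hL0.trans hIS.1).trans_le hx.1
      have hy0 : 0 < y := (hL0.trans hIS.1).trans_le hy.1
      rw [ratMap, div_eq_one_iff_eq (by positivity), h, zero_add]
    exact le_antisymm hIS.2.1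
      ((hIS.forall_le fun x hx y hy => (hone x hx y hy).le).trans
        (hIS.le_of_forall fun x hx y hy => (hone x hx y hy).ge))
  · -- decreasing in both coordinates, above `1`
    right
    have hsy : ∀ y : ℝ, (q - q) * y < q * r := fun y => by nlinarith
    have hsx : ∀ x : ℝ, (q - q) * x < r := fun x => by linarith
    have hgt : ∀ x y : ℝ, 0 < x → 0 < y → 1 < ratMap q q r x y := fun x y hx hy => by
      rw [lt_ratMap_iff hq hx hy]; linarith
    have hle : ∀ x y : ℝ, 1 ≤ x → 1 ≤ y → ratMap q q r x y ≤ ratMap q q r 1 1 :=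
      fun x y hx hy => (ratMap_anti_snd hq (by linarith) one_pos hy (hsx _).le).trans
        (ratMap_anti_fst hq one_pos one_pos hx (hsy _).le)
    have h11 := hgt 1 1 one_pos one_pos
    obtain ⟨M, hM⟩ := exists_gt (ratMap q q r 1 1)
    refine ⟨1, M, hL1, h11.trans hM, ?_, ?_, ?_, ?_⟩
    · intro x hx y hy
      exact ⟨(hgt x y (one_pos.trans_le hx.1) (one_pos.trans_le hy.1)).le,
        (hle x y hx.1 hy.1).trans hM.le⟩
    · intro I S hIS
      have hI : 1 < I := hIS.lt_of_forall fun x hx y hy =>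
        hgt x y ((hL0.trans hIS.1).trans_le hx.1) ((hL0.trans hIS.1).trans_le hy.1)
      exact ⟨hI, hIS.forall_lt fun x hx y hy =>
        (hle x y (hI.le.trans hx.1) (hI.le.trans hy.1)).trans_lt hM⟩
    · exact Or.inr fun y hy => strictAntiOn_ratMap_fst hq one_pos (one_pos.trans_le hy.1) (hsy y)
    · exact Or.inr fun x hx => strictAntiOn_ratMap_snd hq one_pos (one_pos.trans_le hx.1) (hsx x)

/-- The case `p > q`, `r ≥ 0`, written with `p = s q` and `r = (s - 1) K`. -/
lemma dichotomy_of_gt_of_nonneg {s K : ℝ} (hq : 0 < q) (hL0 : 0 < L) (hL1 : L < 1)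
    (hs : 1 < s) (hK : 0 ≤ K) : Dichotomy (s * q) q ((s - 1) * K) L := by
  have hd : 0 < (s - 1) * q := mul_pos (sub_pos.2 hs) hq
  have hs1 : 0 < s - 1 := sub_pos.2 hs
  have hs0 : 0 < s := by linarith
  set f := ratMap (s * q) q ((s - 1) * K) with hf
  have hinc : ∀ y, K < y → q * ((s - 1) * K) < (s * q - q) * y := fun y hy => by
    nlinarith [mul_lt_mul_of_pos_left hy hd]
  have hinc' : ∀ y, K ≤ y → q * ((s - 1) * K) ≤ (s * q - q) * y := fun y hy => by
    nlinarith [mul_le_mul_of_nonneg_left hy hd.le]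
  have hdec : ∀ y, y < K → (s * q - q) * y < q * ((s - 1) * K) := fun y hy => by
    nlinarith [mul_lt_mul_of_pos_left hy hd]
  have hdec' : ∀ y, y ≤ K → (s * q - q) * y ≤ q * ((s - 1) * K) := fun y hy => by
    nlinarith [mul_le_mul_of_nonneg_left hy hd.le]
  have hsnd : ∀ x, 0 < x → (q - s * q) * x < (s - 1) * K := fun x hx => by
    nlinarith [mul_pos hd hx, mul_nonneg hs1.le hK]
  have hgt1 : ∀ x y, 0 < x → 0 < y → 1 < f x y := fun x y hx hy => by
    rw [hf, lt_ratMap_iff hq hx hy]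
    nlinarith [mul_pos hd hx, mul_nonneg hs1.le hK]
  have hges : ∀ x y, 0 < x → 0 < y → y ≤ K → s ≤ f x y := fun x y hx hy h => by
    rw [hf, le_ratMap_iff hq hx hy]
    nlinarith [mul_le_mul_of_nonneg_left h hs1.le]
  have hles : ∀ x y, 0 < x → 0 < y → K ≤ y → f x y ≤ s := fun x y hx hy h => by
    rw [hf, ratMap_le_iff hq hx hy]
    nlinarith [mul_le_mul_of_nonneg_left h hs1.le]
  have hlts : ∀ x y, 0 < x → 0 < y → K < y → f x y < s := fun x y hx hy h => by
    rw [hf, ratMap_lt_iff hq hx hy]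
    nlinarith [mul_lt_mul_of_pos_left h hs1]
  have hone : ∀ I S, LimitPair (s * q) q ((s - 1) * K) L I S → 1 < I := fun I S h =>
    h.lt_of_forall fun x hx y hy =>
      hgt1 x y ((hL0.trans h.1).trans_le hx.1) ((hL0.trans h.1).trans_le hy.1)
  -- the critical line does not separate a nondegenerate limit pair
  have hsep : ∀ I S, LimitPair (s * q) q ((s - 1) * K) L I S → I ≤ K → K ≤ S → I = S := by
    intro I S h hIK hKS
    have hI0 : 0 < I := hL0.trans h.1
    have hS0 : 0 < S := hI0.trans_le h.2.1
    have h1 : f I S ≤ I := h.le_of_forall fun x hx y hy =>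
      (ratMap_mono_fst hq hI0 hS0 hx.1 (hinc' _ hKS)).trans
        (ratMap_anti_snd hq (hI0.trans_le hx.1) (hI0.trans_le hy.1) hy.2
          (hsnd x (hI0.trans_le hx.1)).le)
    have h2 : S ≤ f I I := h.forall_le fun x hx y hy =>
      (ratMap_anti_snd hq (hI0.trans_le hx.1) hI0 hy.1 (hsnd x (hI0.trans_le hx.1)).le).trans
        (ratMap_anti_fst hq hI0 hI0 hx.1 (hdec' _ hIK))
    rw [hf, ratMap_le_iff hq hI0 hS0] at h1
    rw [hf, le_ratMap_iff hq hI0 hI0] at h2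
    refine le_antisymm h.2.1 ?_
    by_contra! hlt
    nlinarith [mul_pos (mul_pos hq hI0) (sub_pos.2 hlt)]
  rcases lt_trichotomy K s with hKs | hKs | hKs
  · right
    -- increasing, then decreasing, on an interval inside `(K, s]`
    set k := max K 1 with hk
    have hk1 : 1 ≤ k := le_max_right _ _
    have hkK : K ≤ k := le_max_left _ _
    have hks : k < s := max_lt hKs hs
    have hk0 : 0 < k := by linarith
    have hIk : ∀ I S, LimitPair (s * q) q ((s - 1) * K) L I S → k ≤ I ∧ S ≤ s := by
      intro I S h
      have hI0 : 0 < I := hL0.trans h.1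
      have hKI : K ≤ I := by
        by_contra! hIK
        rcases le_or_gt K S with hKS | hKS
        · have := hsep I S h hIK.le hKS
          linarith
        · have : s ≤ I := h.le_of_forall fun x hx y hy =>
            hges x y (hI0.trans_le hx.1) (hI0.trans_le hy.1) (hy.2.trans hKS.le)
          linarith
      exact ⟨max_le hKI (hone I S h).le, h.forall_le fun x hx y hy =>
        hles x y (hI0.trans_le hx.1) (hI0.trans_le hy.1) (hKI.trans hy.1)⟩
    have hc : k < f k s := by
      rcases max_cases K 1 with ⟨e, -⟩ | ⟨e, -⟩
      · rw [← hk] at e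
        rw [hf, lt_ratMap_iff hq hk0 hs0, e]
        rw [e] at hk1
        nlinarith [mul_pos (sub_pos.2 hKs) (mul_pos hq (one_pos.trans_le hk1)),
          mul_pos (sub_pos.2 hKs) hs0, mul_pos (sub_pos.2 hKs) hs1]
      · rw [← hk] at e
        rw [e]
        exact hgt1 1 s one_pos hs0
    have hge : ∀ x ∈ Icc k s, ∀ y ∈ Icc k s, f k s ≤ f x y := fun x hx y hy =>
      (ratMap_mono_fst hq hk0 hs0 hx.1 (hinc' _ hKs.le)).trans
        (ratMap_anti_snd hq (hk0.trans_le hx.1) (hk0.trans_le hy.1) hy.2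
          (hsnd x (hk0.trans_le hx.1)).le)
    obtain ⟨m, hkm, hm⟩ := exists_between hc
    have hm0 : 0 < m := hk0.trans hkm
    refine ⟨m, s, by linarith, hm.trans_le (hles k s hk0 hs0 hKs.le), ?_, ?_, ?_, ?_⟩
    · intro x hx y hy
      exact ⟨hm.le.trans (hge x ⟨hkm.le.trans hx.1, hx.2⟩ y ⟨hkm.le.trans hy.1, hy.2⟩),
        hles x y (hm0.trans_le hx.1) (hm0.trans_le hy.1) (hkK.trans (hkm.le.trans hy.1))⟩
    · intro I S h
      obtain ⟨h1, h2⟩ := hIk I S h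
      have hmI : m < I := h.lt_of_forall fun x hx y hy =>
        hm.trans_le (hge x ⟨h1.trans hx.1, hx.2.trans h2⟩ y ⟨h1.trans hy.1, hy.2.trans h2⟩)
      exact ⟨hmI, h.forall_lt fun x hx y hy => hlts x y ((hm0.trans hmI).trans_le hx.1)
        ((hm0.trans hmI).trans_le hy.1) ((hkK.trans_lt (hkm.trans hmI)).trans_le hy.1)⟩
    · exact Or.inl fun y hy => strictMonoOn_ratMap_fst hq hm0 (hm0.trans_le hy.1)
        (hinc y ((hkK.trans_lt hkm).trans_le hy.1))
    · exact Or.inr fun x hx => strictAntiOn_ratMap_snd hq hm0 (hm0.trans_le hx.1)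
        (hsnd x (hm0.trans_le hx.1))
  · left
    intro I S h
    have hI0 : 0 < I := hL0.trans h.1
    rcases le_total I K with hIK | hIK
    · rcases le_total K S with hKS | hKS
      · exact hsep I S h hIK hKS
      · have : s ≤ I := h.le_of_forall fun x hx y hy =>
          hges x y (hI0.trans_le hx.1) (hI0.trans_le hy.1) (hy.2.trans hKS)
        linarith [h.2.1]
    · have : S ≤ s := h.forall_le fun x hx y hy =>
        hles x y (hI0.trans_le hx.1) (hI0.trans_le hy.1) (hIK.trans hy.1)
      linarith [h.2.1]
  · right
    -- decreasing in both coordinates on an interval inside `[s, K)`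
    have hc : f s s < K := by
      rw [hf, ratMap_lt_iff hq hs0 hs0]
      nlinarith [mul_pos (sub_pos.2 hKs) (mul_pos hq hs0), sub_pos.2 hKs]
    obtain ⟨M, hcM, hM⟩ := exists_between hc
    have hsM : s < M := (hges s s hs0 hs0 hKs.le).trans_lt hcM
    have hle : ∀ x ∈ Ici s, ∀ y ∈ Icc s K, f x y ≤ f s s := fun x hx y hy =>
      (ratMap_anti_snd hq (hs0.trans_le hx) hs0 hy.1 (hsnd x (hs0.trans_le hx)).le).trans
        (ratMap_anti_fst hq hs0 hs0 hx (hdec' _ hKs.le))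
    have hgts : ∀ x y, 0 < x → 0 < y → y < K → s < f x y := fun x y hx hy h => by
      rw [hf, lt_ratMap_iff hq hx hy]
      nlinarith [mul_lt_mul_of_pos_left h hs1]
    refine ⟨s, M, by linarith, hsM, ?_, ?_, ?_, ?_⟩
    · intro x hx y hy
      exact ⟨hges x y (hs0.trans_le hx.1) (hs0.trans_le hy.1) (hy.2.trans hM.le),
        (hle x hx.1 y ⟨hy.1, hy.2.trans hM.le⟩).trans hcM.le⟩
    · intro I S h
      have hI0 : 0 < I := hL0.trans h.1
      have hSK : S ≤ K := by
        by_contra! hKS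
        rcases le_or_gt I K with hIK | hIK
        · have := hsep I S h hIK hKS.le
          linarith
        · have : S ≤ s := h.forall_le fun x hx y hy =>
            hles x y (hI0.trans_le hx.1) (hI0.trans_le hy.1) (hIK.le.trans hy.1)
          linarith
      have hsI : s ≤ I := h.le_of_forall fun x hx y hy =>
        hges x y (hI0.trans_le hx.1) (hI0.trans_le hy.1) (hy.2.trans hSK)
      have hSM : S < M := h.forall_lt fun x hx y hy =>
        (hle x (hsI.trans hx.1) y ⟨hsI.trans hy.1, hy.2.trans hSK⟩).trans_lt hcM
      exact ⟨h.lt_of_forall fun x hx y hy => hgts x y (hI0.trans_le hx.1) (hI0.trans_le hy.1)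
        (hy.2.trans_lt (hSM.trans hM)), hSM⟩
    · exact Or.inr fun y hy => strictAntiOn_ratMap_fst hq hs0 (hs0.trans_le hy.1)
        (hdec y (hy.2.trans_lt hM))
    · exact Or.inr fun x hx => strictAntiOn_ratMap_snd hq hs0 (hs0.trans_le hx.1)
        (hsnd x (hs0.trans_le hx.1))

/-- The case `p > q`, `r < 0`, written with `r = -(p - q) J`. -/
lemma dichotomy_of_gt_of_neg {p J : ℝ} (hq : 0 < q) (hL0 : 0 < L) (hL1 : L < 1)
    (hpq : q < p) (hJ : 0 < J) (hr : (q + 1) * L ^ 2 < -((p - q) * J) + (p + 1) * L) :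
    Dichotomy p q (-((p - q) * J)) L := by
  have hd : 0 < p - q := sub_pos.2 hpq
  set f := ratMap p q (-((p - q) * J)) with hf
  have hdJ : 0 < q * ((p - q) * J) := by positivity
  have hfst : ∀ y, 0 < y → q * (-((p - q) * J)) < (p - q) * y := fun y hy => by
    nlinarith [mul_pos hd hy]
  have hinc : ∀ x, x < J → -((p - q) * J) < (q - p) * x := fun x hx => by
    nlinarith [mul_lt_mul_of_pos_left hx hd]
  have hinc' : ∀ x, x ≤ J → -((p - q) * J) ≤ (q - p) * x := fun x hx => by
    nlinarith [mul_le_mul_of_nonneg_left hx hd.le]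
  have hdec : ∀ x, J < x → (q - p) * x < -((p - q) * J) := fun x hx => by
    nlinarith [mul_lt_mul_of_pos_left hx hd]
  have hdec' : ∀ x, J ≤ x → (q - p) * x ≤ -((p - q) * J) := fun x hx => by
    nlinarith [mul_le_mul_of_nonneg_left hx hd.le]
  have hge1 : ∀ x y, 0 < x → 0 < y → J ≤ x → 1 ≤ f x y := fun x y hx hy h => by
    rw [hf, le_ratMap_iff hq hx hy]
    nlinarith [mul_le_mul_of_nonneg_left h hd.le]
  have hgt1 : ∀ x y, 0 < x → 0 < y → J < x → 1 < f x y := fun x y hx hy h => by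
    rw [hf, lt_ratMap_iff hq hx hy]
    nlinarith [mul_lt_mul_of_pos_left h hd]
  have hlt1 : ∀ x y, 0 < x → 0 < y → x < J → f x y < 1 := fun x y hx hy h => by
    rw [hf, ratMap_lt_iff hq hx hy]
    nlinarith [mul_lt_mul_of_pos_left h hd]
  -- a limit pair starting below the critical line satisfies the lower fixed point inequality
  have hlow : ∀ I S, LimitPair p q (-((p - q) * J)) L I S → I ≤ J →
      -((p - q) * J) + (p + 1) * I ≤ (q + 1) * I ^ 2 := by
    intro I S h hIJ
    have hI0 : 0 < I := hL0.trans h.1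
    have h1 : f I I ≤ I := h.le_of_forall fun x hx y hy =>
      (ratMap_mono_snd hq hI0 hI0 hy.1 (hinc' I hIJ)).trans
        (ratMap_mono_fst hq hI0 (hI0.trans_le hy.1) hx.1 (hfst y (hI0.trans_le hy.1)).le)
    rw [hf, ratMap_le_iff hq hI0 hI0] at h1
    linarith
  -- and one ending above it the upper inequality
  have hhigh : ∀ I S, LimitPair p q (-((p - q) * J)) L I S → J ≤ S →
      S * (q * S + I) ≤ -((p - q) * J) + p * S + I := by
    intro I S h hJS
    have hI0 : 0 < I := hL0.trans h.1
    have hS0 : 0 < S := hI0.trans_le h.2.1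
    have h1 : S ≤ f S I := h.forall_le fun x hx y hy =>
      (ratMap_mono_fst hq (hI0.trans_le hx.1) (hI0.trans_le hy.1) hx.2
        (hfst y (hI0.trans_le hy.1)).le).trans
        (ratMap_anti_snd hq hS0 hI0 hy.1 (hdec' S hJS))
    rwa [hf, le_ratMap_iff hq hS0 hI0] at h1
  rcases lt_trichotomy J 1 with hJ1 | hJ1 | hJ1
  · right
    have hp0 : 0 < p := hq.trans hpq
    have hlts : ∀ x y, 0 < x → 0 < y → f x y < p / q := fun x y hx hy => by
      rw [hf, ratMap_lt_iff hq hx hy]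
      have e : p / q * (q * x + y) = p * x + p / q * y := by field_simp
      have : y < p / q * y := lt_mul_left hy ((one_lt_div hq).2 hpq)
      nlinarith [mul_pos hd hJ]
    refine ⟨1, p / q, hL1, (one_lt_div hq).2 hpq, ?_, ?_, ?_, ?_⟩
    · intro x hx y hy
      have hx0 : 0 < x := one_pos.trans_le hx.1
      have hy0 : 0 < y := one_pos.trans_le hy.1
      exact ⟨hge1 x y hx0 hy0 (hJ1.le.trans hx.1), (hlts x y hx0 hy0).le⟩
    · intro I S h
      have hI0 : 0 < I := hL0.trans h.1
      have hJI : J ≤ I := by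
        by_contra! hIJ
        have h1 := hlow I S h hIJ.le
        have hI1 : I < 1 := hIJ.trans hJ1
        have hLI := h.1
        -- the quadratic is negative at `L` and at `1`, hence in between
        nlinarith [mul_pos (mul_pos (sub_pos.2 hLI) (sub_pos.2 hI1)) (by linarith : 0 < q + 1),
          mul_pos hd (sub_pos.2 hJ1), mul_lt_mul_of_pos_right hr (sub_pos.2 hI1),
          mul_pos (mul_pos hd (sub_pos.2 hJ1)) (sub_pos.2 hLI),
          mul_pos (sub_pos.2 hLI) (sub_pos.2 hI1), mul_le_mul_of_nonneg_right h1 (sub_pos.2 hL1).le]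
      have h1I : 1 ≤ I := h.le_of_forall fun x hx y hy =>
        hge1 x y (hI0.trans_le hx.1) (hI0.trans_le hy.1) (hJI.trans hx.1)
      exact ⟨h.lt_of_forall fun x hx y hy => hgt1 x y (hI0.trans_le hx.1) (hI0.trans_le hy.1)
          ((hJ1.trans_le h1I).trans_le hx.1),
        h.forall_lt fun x hx y hy => hlts x y (hI0.trans_le hx.1) (hI0.trans_le hy.1)⟩
    · exact Or.inl fun y hy => strictMonoOn_ratMap_fst hq one_pos (one_pos.trans_le hy.1)
        (hfst y (one_pos.trans_le hy.1))
    · exact Or.inr fun x hx => strictAntiOn_ratMap_snd hq one_pos (one_pos.trans_le hx.1)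
        (hdec x (hJ1.trans_le hx.1))
  · left
    intro I S h
    subst hJ1
    have hLI := h.1
    have hroot : p - q < (q + 1) * L := by
      by_contra! hc
      nlinarith [mul_nonneg (sub_nonneg.2 hc) (sub_pos.2 hL1).le]
    have hS1 : S ≤ 1 := by
      by_contra! hc
      have h1 := hhigh I S h hc.le
      have h2 : 0 < q * S + I - (p - q) := by nlinarith [mul_pos hq (sub_pos.2 hc)]
      nlinarith [mul_pos (sub_pos.2 hc) h2]
    have hI1 : 1 ≤ I := by
      by_contra! hc
      have h1 := hlow I S h hc.le
      have h2 : 0 < (q + 1) * I - (p - q) := by nlinarith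
      nlinarith [mul_pos (sub_pos.2 hc) h2]
    linarith [h.2.1]
  · right
    have hvert : p + 1 < 2 * (q + 1) := by
      by_contra! hc
      nlinarith [mul_nonneg (sub_nonneg.2 hc) (sub_pos.2 hL1).le, mul_pos hd (sub_pos.2 hJ1),
        mul_pos hq (mul_pos (sub_pos.2 hL1) (sub_pos.2 hL1)),
        mul_pos (sub_pos.2 hL1) (sub_pos.2 hL1)]
    have hSJ : ∀ I S, LimitPair p q (-((p - q) * J)) L I S → S < J := by
      intro I S h
      by_contra! hJS
      have h1 := hhigh I S h hJS
      have hLI := h.1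
      have hI0 : 0 < I := hL0.trans hLI
      have hIv : p + 1 ≤ 2 * (q + 1) * I := by
        rcases le_total I J with hIJ | hJI
        · have h2 := hlow I S h hIJ
          by_contra! hc
          nlinarith [mul_pos (sub_pos.2 hLI) (sub_pos.2 hc),
            mul_pos hq (mul_pos (sub_pos.2 hLI) (sub_pos.2 hLI)),
            mul_pos (sub_pos.2 hLI) (sub_pos.2 hLI)]
        · nlinarith [mul_pos hq (sub_pos.2 (hJ1.trans_le hJI))]
      -- the right vertex lies left of `1`, and the inequality fails at `J`
      have hv : p - I < 2 * q := by nlinarith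
      have h3 : 0 < (J - 1) * (q * J + I) := by
        have := sub_pos.2 hJ1
        positivity
      nlinarith [mul_nonneg (sub_nonneg.2 hJS) (sub_pos.2 hv).le,
        mul_nonneg hq.le (mul_nonneg (sub_nonneg.2 hJS) (sub_nonneg.2 hJS)),
        mul_nonneg hq.le (mul_nonneg (sub_nonneg.2 hJS) (sub_pos.2 hJ1).le)]
    have hbig : L < f L L := by
      rw [hf, lt_ratMap_iff hq hL0 hL0]; linarith
    obtain ⟨m, hm, hmc⟩ := exists_between hbig
    have hm0 : 0 < m := hL0.trans hm
    have hge : ∀ x y : ℝ, L ≤ x → L ≤ y → f L L ≤ f x y := fun x y hx hy =>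
      (ratMap_mono_snd hq hL0 hL0 hy (hinc L (hL1.trans hJ1)).le).trans
        (ratMap_mono_fst hq hL0 (hL0.trans_le hy) hx (hfst y (hL0.trans_le hy)).le)
    refine ⟨m, 1, hm, hmc.trans (hlt1 L L hL0 hL0 (hL1.trans hJ1)), ?_, ?_, ?_, ?_⟩
    · intro x hx y hy
      exact ⟨hmc.le.trans (hge x y (hm.le.trans hx.1) (hm.le.trans hy.1)),
        (hlt1 x y (hm0.trans_le hx.1) (hm0.trans_le hy.1) (hx.2.trans_lt hJ1)).le⟩
    · intro I S h
      have hI := h.1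
      exact ⟨h.lt_of_forall fun x hx y hy =>
          hmc.trans_le (hge x y (hI.le.trans hx.1) (hI.le.trans hy.1)),
        h.forall_lt fun x hx y hy => hlt1 x y ((hL0.trans hI).trans_le hx.1)
          ((hL0.trans hI).trans_le hy.1) (hx.2.trans_lt (hSJ I S h))⟩
    · exact Or.inl fun y hy => strictMonoOn_ratMap_fst hq hm0 (hm0.trans_le hy.1)
        (hfst y (hm0.trans_le hy.1))
    · exact Or.inl fun x hx => strictMonoOn_ratMap_snd hq hm0 (hm0.trans_le hx.1)
        (hinc x (hx.2.trans_lt hJ1))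

/-- The case `p < q`, `r ≥ 0`, written with `p = s q` and `r = (q - p) J`. -/
lemma dichotomy_of_lt_of_nonneg {s J : ℝ} (hq : 0 < q) (hL0 : 0 < L) (hLs : L < s)
    (hs : s < 1) (hJ : 0 ≤ J) : Dichotomy (s * q) q ((q - s * q) * J) L := by
  have hs0 : 0 < s := hL0.trans hLs
  have hsq : 0 < s * q := mul_pos hs0 hq
  have hd : 0 < q - s * q := by nlinarith
  set f := ratMap (s * q) q ((q - s * q) * J) with hf
  have hdJ : 0 ≤ (q - s * q) * J := by positivity
  have hfst : ∀ y, 0 < y → (s * q - q) * y < q * ((q - s * q) * J) := fun y hy => by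
    nlinarith [mul_pos hd hy, mul_nonneg hq.le hdJ]
  have hinc : ∀ x, J < x → (q - s * q) * J < (q - s * q) * x := fun x hx =>
    mul_lt_mul_of_pos_left hx hd
  have hinc' : ∀ x, J ≤ x → (q - s * q) * J ≤ (q - s * q) * x := fun x hx =>
    mul_le_mul_of_nonneg_left hx hd.le
  have hdec : ∀ x, x < J → (q - s * q) * x < (q - s * q) * J := fun x hx =>
    mul_lt_mul_of_pos_left hx hd
  have hdec' : ∀ x, x ≤ J → (q - s * q) * x ≤ (q - s * q) * J := fun x hx =>
    mul_le_mul_of_nonneg_left hx hd.le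
  have hgts : ∀ x y, 0 < x → 0 < y → s < f x y := fun x y hx hy => by
    rw [hf, lt_ratMap_iff hq hx hy]
    nlinarith [mul_pos (sub_pos.2 hs) hy]
  have hge1 : ∀ x y, 0 < x → 0 < y → x ≤ J → 1 ≤ f x y := fun x y hx hy h => by
    rw [hf, le_ratMap_iff hq hx hy]
    linarith [hdec' x h]
  have hgt1 : ∀ x y, 0 < x → 0 < y → x < J → 1 < f x y := fun x y hx hy h => by
    rw [hf, lt_ratMap_iff hq hx hy]
    linarith [hdec x h]
  have hle1 : ∀ x y, 0 < x → 0 < y → J ≤ x → f x y ≤ 1 := fun x y hx hy h => by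
    rw [hf, ratMap_le_iff hq hx hy]
    linarith [hinc' x h]
  have hlt1 : ∀ x y, 0 < x → 0 < y → J < x → f x y < 1 := fun x y hx hy h => by
    rw [hf, ratMap_lt_iff hq hx hy]
    linarith [hinc x h]
  -- the critical line does not separate a nondegenerate limit pair
  have hsep : ∀ I S, LimitPair (s * q) q ((q - s * q) * J) L I S → I ≤ J → J ≤ S → I = S := by
    intro I S h hIJ hJS
    have hI0 : 0 < I := hL0.trans h.1
    have hS0 : 0 < S := hI0.trans_le h.2.1
    have h1 : f S I ≤ I := h.le_of_forall fun x hx y hy =>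
      (ratMap_mono_snd hq hS0 hI0 hy.1 (hinc' _ hJS)).trans
        (ratMap_anti_fst hq (hI0.trans_le hx.1) (hI0.trans_le hy.1) hx.2
          (hfst y (hI0.trans_le hy.1)).le)
    have h2 : S ≤ f I I := h.forall_le fun x hx y hy =>
      (ratMap_anti_fst hq hI0 (hI0.trans_le hy.1) hx.1 (hfst y (hI0.trans_le hy.1)).le).trans
        (ratMap_anti_snd hq hI0 hI0 hy.1 (hdec' _ hIJ))
    rw [hf, ratMap_le_iff hq hS0 hI0] at h1
    rw [hf, le_ratMap_iff hq hI0 hI0] at h2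
    refine le_antisymm h.2.1 ?_
    by_contra! hlt
    nlinarith [mul_pos (add_pos hI0 hsq) (sub_pos.2 hlt)]
  rcases lt_trichotomy J 1 with hJ1 | hJ1 | hJ1
  · right
    -- decreasing, then increasing, on an interval inside `(J, 1]`
    set k := max J s with hk
    have hsk : s ≤ k := le_max_right _ _
    have hJk : J ≤ k := le_max_left _ _
    have hk1 : k < 1 := max_lt hJ1 hs
    have hk0 : 0 < k := by linarith
    have hIk : ∀ I S, LimitPair (s * q) q ((q - s * q) * J) L I S → k ≤ I ∧ S ≤ 1 := by
      intro I S h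
      have hI0 : 0 < I := hL0.trans h.1
      have hJI : J ≤ I := by
        by_contra! hIJ
        rcases le_or_gt J S with hJS | hJS
        · have := hsep I S h hIJ.le hJS
          linarith
        · have : 1 ≤ I := h.le_of_forall fun x hx y hy =>
            hge1 x y (hI0.trans_le hx.1) (hI0.trans_le hy.1) (hx.2.trans hJS.le)
          linarith
      have hsI : s ≤ I := h.le_of_forall fun x hx y hy =>
        (hgts x y (hI0.trans_le hx.1) (hI0.trans_le hy.1)).le
      exact ⟨max_le hJI hsI, h.forall_le fun x hx y hy =>
        hle1 x y (hI0.trans_le hx.1) (hI0.trans_le hy.1) (hJI.trans hx.1)⟩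
    have hc : k < f 1 k := by
      rcases max_cases J s with ⟨e, -⟩ | ⟨e, -⟩
      · rw [← hk] at e
        rw [hf, lt_ratMap_iff hq one_pos hk0, e]
        rw [e] at hk0
        nlinarith [mul_pos (sub_pos.2 hJ1) hsq, mul_pos (sub_pos.2 hJ1) hk0]
      · rw [← hk] at e
        rw [e]
        exact hgts 1 s one_pos hs0
    have hge : ∀ x ∈ Icc k 1, ∀ y ∈ Icc k 1, f 1 k ≤ f x y := fun x hx y hy =>
      (ratMap_mono_snd hq one_pos hk0 hy.1 (hinc' _ hJ1.le)).trans
        (ratMap_anti_fst hq (hk0.trans_le hx.1) (hk0.trans_le hy.1) hx.2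
          (hfst y (hk0.trans_le hy.1)).le)
    obtain ⟨m, hkm, hm⟩ := exists_between hc
    have hm0 : 0 < m := hk0.trans hkm
    refine ⟨m, 1, by linarith, hm.trans_le (hle1 1 k one_pos hk0 hJ1.le), ?_, ?_, ?_, ?_⟩
    · intro x hx y hy
      exact ⟨hm.le.trans (hge x ⟨hkm.le.trans hx.1, hx.2⟩ y ⟨hkm.le.trans hy.1, hy.2⟩),
        hle1 x y (hm0.trans_le hx.1) (hm0.trans_le hy.1) (hJk.trans (hkm.le.trans hx.1))⟩
    · intro I S h
      obtain ⟨h1, h2⟩ := hIk I S h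
      have hmI : m < I := h.lt_of_forall fun x hx y hy =>
        hm.trans_le (hge x ⟨h1.trans hx.1, hx.2.trans h2⟩ y ⟨h1.trans hy.1, hy.2.trans h2⟩)
      exact ⟨hmI, h.forall_lt fun x hx y hy => hlt1 x y ((hm0.trans hmI).trans_le hx.1)
        ((hm0.trans hmI).trans_le hy.1) ((hJk.trans_lt (hkm.trans hmI)).trans_le hx.1)⟩
    · exact Or.inr fun y hy => strictAntiOn_ratMap_fst hq hm0 (hm0.trans_le hy.1)
        (hfst y (hm0.trans_le hy.1))
    · exact Or.inl fun x hx => strictMonoOn_ratMap_snd hq hm0 (hm0.trans_le hx.1)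
        (hinc x ((hJk.trans_lt hkm).trans_le hx.1))
  · left
    intro I S h
    have hI0 : 0 < I := hL0.trans h.1
    rcases le_total I J with hIJ | hIJ
    · rcases le_total J S with hJS | hJS
      · exact hsep I S h hIJ hJS
      · have : 1 ≤ I := h.le_of_forall fun x hx y hy =>
          hge1 x y (hI0.trans_le hx.1) (hI0.trans_le hy.1) (hx.2.trans hJS)
        linarith [h.2.1]
    · have : S ≤ 1 := h.forall_le fun x hx y hy =>
        hle1 x y (hI0.trans_le hx.1) (hI0.trans_le hy.1) (hIJ.trans hx.1)
      linarith [h.2.1]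
  · right
    -- decreasing in both coordinates on an interval inside `[1, J)`
    have hc : f 1 1 < J := by
      rw [hf, ratMap_lt_iff hq one_pos one_pos]
      nlinarith [mul_pos (sub_pos.2 hJ1) hsq]
    obtain ⟨M, hcM, hM⟩ := exists_between hc
    have h1M : 1 < M := (hgt1 1 1 one_pos one_pos hJ1).trans hcM
    have hle : ∀ x ∈ Icc 1 J, ∀ y ∈ Ici 1, f x y ≤ f 1 1 := fun x hx y hy =>
      (ratMap_anti_snd hq (one_pos.trans_le hx.1) one_pos hy (hdec' _ hx.2)).trans
        (ratMap_anti_fst hq one_pos one_pos hx.1 (hfst 1 one_pos).le)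
    refine ⟨1, M, by linarith, h1M, ?_, ?_, ?_, ?_⟩
    · intro x hx y hy
      exact ⟨hge1 x y (one_pos.trans_le hx.1) (one_pos.trans_le hy.1) (hx.2.trans hM.le),
        (hle x ⟨hx.1, hx.2.trans hM.le⟩ y hy.1).trans hcM.le⟩
    · intro I S h
      have hI0 : 0 < I := hL0.trans h.1
      have hSJ : S ≤ J := by
        by_contra! hJS
        rcases le_or_gt I J with hIJ | hIJ
        · have := hsep I S h hIJ hJS.le
          linarith
        · have : S ≤ 1 := h.forall_le fun x hx y hy =>
            hle1 x y (hI0.trans_le hx.1) (hI0.trans_le hy.1) (hIJ.le.trans hx.1)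
          linarith
      have h1I : 1 ≤ I := h.le_of_forall fun x hx y hy =>
        hge1 x y (hI0.trans_le hx.1) (hI0.trans_le hy.1) (hx.2.trans hSJ)
      have hSM : S < M := h.forall_lt fun x hx y hy =>
        (hle x ⟨h1I.trans hx.1, hx.2.trans hSJ⟩ y (h1I.trans hy.1)).trans_lt hcM
      exact ⟨h.lt_of_forall fun x hx y hy => hgt1 x y (hI0.trans_le hx.1) (hI0.trans_le hy.1)
        (hx.2.trans_lt (hSM.trans hM)), hSM⟩
    · exact Or.inr fun y hy => strictAntiOn_ratMap_fst hq one_pos (one_pos.trans_le hy.1)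
        (hfst y (one_pos.trans_le hy.1))
    · exact Or.inr fun x hx => strictAntiOn_ratMap_snd hq one_pos (one_pos.trans_le hx.1)
        (hdec x (hx.2.trans_lt hM))

/-- The case `p < q`, `r < 0`, written with `p = s q` and `r = -(1 - s) K`. -/
lemma dichotomy_of_lt_of_neg {s K : ℝ} (hq : 0 < q) (hL0 : 0 < L) (hLs : L < s)
    (hs : s < 1) (hK : 0 < K)
    (hr : (q + 1) * L ^ 2 < -((1 - s) * K) + (s * q + 1) * L) :
    Dichotomy (s * q) q (-((1 - s) * K)) L := by
  have hs0 : 0 < s := hL0.trans hLs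
  have hd : 0 < 1 - s := sub_pos.2 hs
  have hdq : 0 < q * (1 - s) := mul_pos hq hd
  set f := ratMap (s * q) q (-((1 - s) * K)) with hf
  have hdK : 0 < (1 - s) * K := by positivity
  have hsnd : ∀ x, 0 < x → -((1 - s) * K) < (q - s * q) * x := fun x hx => by
    nlinarith [mul_pos hdq hx]
  have hinc : ∀ y, y < K → q * (-((1 - s) * K)) < (s * q - q) * y := fun y hy => by
    nlinarith [mul_lt_mul_of_pos_left hy hdq]
  have hinc' : ∀ y, y ≤ K → q * (-((1 - s) * K)) ≤ (s * q - q) * y := fun y hy => by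
    nlinarith [mul_le_mul_of_nonneg_left hy hdq.le]
  have hdec : ∀ y, K < y → (s * q - q) * y < q * (-((1 - s) * K)) := fun y hy => by
    nlinarith [mul_lt_mul_of_pos_left hy hdq]
  have hdec' : ∀ y, K ≤ y → (s * q - q) * y ≤ q * (-((1 - s) * K)) := fun y hy => by
    nlinarith [mul_le_mul_of_nonneg_left hy hdq.le]
  have hlt1 : ∀ x y, 0 < x → 0 < y → f x y < 1 := fun x y hx hy => by
    rw [hf, ratMap_lt_iff hq hx hy]
    nlinarith [mul_pos hdq hx]
  have hges : ∀ x y, 0 < x → 0 < y → K ≤ y → s ≤ f x y := fun x y hx hy h => by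
    rw [hf, le_ratMap_iff hq hx hy]
    nlinarith [mul_le_mul_of_nonneg_left h hd.le]
  have hgts : ∀ x y, 0 < x → 0 < y → K < y → s < f x y := fun x y hx hy h => by
    rw [hf, lt_ratMap_iff hq hx hy]
    nlinarith [mul_lt_mul_of_pos_left h hd]
  have hlts : ∀ x y, 0 < x → 0 < y → y < K → f x y < s := fun x y hx hy h => by
    rw [hf, ratMap_lt_iff hq hx hy]
    nlinarith [mul_lt_mul_of_pos_left h hd]
  -- a limit pair starting below the critical line satisfies the lower fixed point inequality
  have hlow : ∀ I S, LimitPair (s * q) q (-((1 - s) * K)) L I S → I ≤ K →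
      -((1 - s) * K) + (s * q + 1) * I ≤ (q + 1) * I ^ 2 := by
    intro I S h hIK
    have hI0 : 0 < I := hL0.trans h.1
    have h1 : f I I ≤ I := h.le_of_forall fun x hx y hy =>
      (ratMap_mono_fst hq hI0 hI0 hx.1 (hinc' I hIK)).trans
        (ratMap_mono_snd hq (hI0.trans_le hx.1) hI0 hy.1 (hsnd x (hI0.trans_le hx.1)).le)
    rw [hf, ratMap_le_iff hq hI0 hI0] at h1
    linarith
  -- and one ending above it the upper inequality
  have hhigh : ∀ I S, LimitPair (s * q) q (-((1 - s) * K)) L I S → K ≤ S →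
      S * (q * I + S) ≤ -((1 - s) * K) + s * q * I + S := by
    intro I S h hKS
    have hI0 : 0 < I := hL0.trans h.1
    have hS0 : 0 < S := hI0.trans_le h.2.1
    have h1 : S ≤ f I S := h.forall_le fun x hx y hy =>
      (ratMap_mono_snd hq (hI0.trans_le hx.1) (hI0.trans_le hy.1) hy.2
        (hsnd x (hI0.trans_le hx.1)).le).trans
        (ratMap_anti_fst hq hI0 hS0 hx.1 (hdec' S hKS))
    rwa [hf, le_ratMap_iff hq hI0 hS0] at h1
  rcases lt_trichotomy K s with hKs | hKs | hKs
  · right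
    refine ⟨s, 1, hLs, hs, ?_, ?_, ?_, ?_⟩
    · intro x hx y hy
      have hx0 : 0 < x := hs0.trans_le hx.1
      have hy0 : 0 < y := hs0.trans_le hy.1
      exact ⟨hges x y hx0 hy0 (hKs.le.trans hy.1), (hlt1 x y hx0 hy0).le⟩
    · intro I S h
      have hI0 : 0 < I := hL0.trans h.1
      have hKI : K ≤ I := by
        by_contra! hIK
        have h1 := hlow I S h hIK.le
        have hIs : I < s := hIK.trans hKs
        have hLI := h.1
        -- the quadratic is negative at `L` and at `s`, hence in between
        have h2 : 0 < (1 - s) * (s - K) := mul_pos hd (sub_pos.2 hKs)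
        nlinarith [mul_pos (mul_pos (sub_pos.2 hLI) (sub_pos.2 hIs))
            (mul_pos (by linarith : 0 < q + 1) (sub_pos.2 hLs)),
          mul_lt_mul_of_pos_right hr (sub_pos.2 hIs), mul_pos h2 (sub_pos.2 hLI),
          mul_le_mul_of_nonneg_right h1 (sub_pos.2 hLs).le]
      have hsI : s ≤ I := h.le_of_forall fun x hx y hy =>
        hges x y (hI0.trans_le hx.1) (hI0.trans_le hy.1) (hKI.trans hy.1)
      exact ⟨h.lt_of_forall fun x hx y hy => hgts x y (hI0.trans_le hx.1) (hI0.trans_le hy.1)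
          ((hKs.trans_le hsI).trans_le hy.1),
        h.forall_lt fun x hx y hy => hlt1 x y (hI0.trans_le hx.1) (hI0.trans_le hy.1)⟩
    · exact Or.inr fun y hy => strictAntiOn_ratMap_fst hq hs0 (hs0.trans_le hy.1)
        (hdec y (hKs.trans_le hy.1))
    · exact Or.inl fun x hx => strictMonoOn_ratMap_snd hq hs0 (hs0.trans_le hx.1)
        (hsnd x (hs0.trans_le hx.1))
  · left
    intro I S h
    subst hKs
    have hLI := h.1
    have hroot : 1 - K < (q + 1) * L := by
      by_contra! hc
      nlinarith [mul_nonneg (sub_nonneg.2 hc) (sub_pos.2 hLs).le]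
    have hSK : S ≤ K := by
      by_contra! hc
      have h1 := hhigh I S h hc.le
      have h2 : 0 < S + q * I + K - 1 := by nlinarith [mul_pos hq (sub_pos.2 hLI)]
      nlinarith [mul_pos (sub_pos.2 hc) h2]
    have hKI : K ≤ I := by
      by_contra! hc
      have h1 := hlow I S h hc.le
      have h2 : 0 < (q + 1) * I - (1 - K) := by nlinarith
      nlinarith [mul_pos (sub_pos.2 hc) h2]
    linarith [h.2.1]
  · right
    have hvert : s * q + 1 < 2 * (q + 1) * s := by
      by_contra! hc
      nlinarith [mul_nonneg (sub_nonneg.2 hc) (sub_pos.2 hLs).le, mul_pos hd (sub_pos.2 hKs),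
        mul_pos hq (mul_pos (sub_pos.2 hLs) (sub_pos.2 hLs)),
        mul_pos (sub_pos.2 hLs) (sub_pos.2 hLs)]
    have hSK : ∀ I S, LimitPair (s * q) q (-((1 - s) * K)) L I S → S < K := by
      intro I S h
      by_contra! hKS
      have h1 := hhigh I S h hKS
      have hLI := h.1
      have hI0 : 0 < I := hL0.trans hLI
      have hIv : s * q + 1 ≤ 2 * (q + 1) * I := by
        rcases le_total I K with hIK | hKI
        · have h2 := hlow I S h hIK
          by_contra! hc
          nlinarith [mul_pos (sub_pos.2 hLI) (sub_pos.2 hc),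
            mul_pos hq (mul_pos (sub_pos.2 hLI) (sub_pos.2 hLI)),
            mul_pos (sub_pos.2 hLI) (sub_pos.2 hLI)]
        · nlinarith [mul_pos hq (sub_pos.2 (hKs.trans_le hKI))]
      -- the right vertex lies left of `s`, and the inequality fails at `K`
      have hv : 1 - q * I < 2 * s := by
        by_contra! hc
        nlinarith [mul_le_mul_of_nonneg_left hIv hq.le]
      have h3 : 0 < (K - s) * (K + q * I) := by
        have := sub_pos.2 hKs
        positivity
      nlinarith [mul_nonneg (sub_nonneg.2 hKS) (sub_pos.2 hv).le,
        mul_nonneg (sub_nonneg.2 hKS) (sub_nonneg.2 hKS),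
        mul_nonneg (sub_nonneg.2 hKS) (sub_pos.2 hKs).le]
    have hbig : L < f L L := by
      rw [hf, lt_ratMap_iff hq hL0 hL0]; linarith
    obtain ⟨m, hm, hmc⟩ := exists_between hbig
    have hm0 : 0 < m := hL0.trans hm
    have hge : ∀ x y : ℝ, L ≤ x → L ≤ y → f L L ≤ f x y := fun x y hx hy =>
      (ratMap_mono_fst hq hL0 hL0 hx (hinc L (hLs.trans hKs)).le).trans
        (ratMap_mono_snd hq (hL0.trans_le hx) hL0 hy (hsnd x (hL0.trans_le hx)).le)
    refine ⟨m, s, hm, hmc.trans (hlts L L hL0 hL0 (hLs.trans hKs)), ?_, ?_, ?_, ?_⟩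
    · intro x hx y hy
      exact ⟨hmc.le.trans (hge x y (hm.le.trans hx.1) (hm.le.trans hy.1)),
        (hlts x y (hm0.trans_le hx.1) (hm0.trans_le hy.1) (hy.2.trans_lt hKs)).le⟩
    · intro I S h
      have hI := h.1
      exact ⟨h.lt_of_forall fun x hx y hy =>
          hmc.trans_le (hge x y (hI.le.trans hx.1) (hI.le.trans hy.1)),
        h.forall_lt fun x hx y hy => hlts x y ((hL0.trans hI).trans_le hx.1)
          ((hL0.trans hI).trans_le hy.1) (hy.2.trans_lt (hSK I S h))⟩
    · exact Or.inl fun y hy => strictMonoOn_ratMap_fst hq hm0 (hm0.trans_le hy.1)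
        (hinc y (hy.2.trans_lt hKs))
    · exact Or.inl fun x hx => strictMonoOn_ratMap_snd hq hm0 (hm0.trans_le hx.1)
        (hsnd x (hm0.trans_le hx.1))

/-- The dichotomy holds for all admissible parameters. -/
lemma dichotomy {p r : ℝ} (hq : 0 < q) (hL0 : 0 < L) (hL1 : L < 1) (hp : L * q < p)
    (hr : (q + 1) * L ^ 2 < r + (p + 1) * L) : Dichotomy p q r L := by
  obtain ⟨s, rfl⟩ : ∃ s, p = s * q := ⟨p / q, by field_simp⟩
  have hLs : L < s := lt_of_mul_lt_mul_right hp hq.le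
  rcases lt_trichotomy s 1 with hs | rfl | hs
  · rcases le_or_gt 0 r with h | h
    · have hd : 0 < q - s * q := by nlinarith
      obtain ⟨J, rfl⟩ : ∃ J, r = (q - s * q) * J := ⟨r / (q - s * q), by field_simp⟩
      exact dichotomy_of_lt_of_nonneg hq hL0 hLs hs (nonneg_of_mul_nonneg_right h hd)
    · have hd : 0 < 1 - s := sub_pos.2 hs
      obtain ⟨K, rfl⟩ : ∃ K, r = -((1 - s) * K) := ⟨-r / (1 - s), by field_simp⟩
      exact dichotomy_of_lt_of_neg hq hL0 hLs hs
        (pos_of_mul_pos_right (neg_lt_zero.1 h) hd.le) hr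
  · rw [one_mul] at hr ⊢
    exact dichotomy_of_eq hq hL0 hL1 hr
  · rcases le_or_gt 0 r with h | h
    · have hd : 0 < s - 1 := sub_pos.2 hs
      obtain ⟨K, rfl⟩ : ∃ K, r = (s - 1) * K := ⟨r / (s - 1), by field_simp⟩
      exact dichotomy_of_gt_of_nonneg hq hL0 hL1 hs (nonneg_of_mul_nonneg_right h hd)
    · have hd : 0 < s * q - q := by nlinarith
      obtain ⟨J, rfl⟩ : ∃ J, r = -((s * q - q) * J) := ⟨-r / (s * q - q), by field_simp⟩
      exact dichotomy_of_gt_of_neg hq hL0 hL1 (sub_pos.1 hd)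
        (pos_of_mul_pos_right (neg_lt_zero.1 h) hd.le) hr

end Cases

/-- Proposition (existence of an invariant and attracting interval for
Eq. (3-2-L)): either every solution converges to the equilibrium, or there
is an invariant, attracting interval `[m*, M*] ⊆ (L, ∞)` on whose square the
associated function is coordinate-wise strictly monotonic.
Here `y 0` plays the role of `y_{-1}` and `y 1` of `y_0`. -/
theorem stmt_4 (α β γ A B C : ℝ)
    (hα : 0 < α) (hβ : 0 < β) (hγ : 0 < γ) (hA : 0 < A) (hB : 0 < B) (hC : 0 < C)
    (p q r L : ℝ)
    (hp : p = (A * B + (B + C) * β) / (A * C + (B + C) * γ))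
    (hq : q = B / C)
    (hr : r = C * (B + C) * (B * α + C * α - A * β - A * γ) / (γ * (B + C) + A * C) ^ 2)
    (hL : L = A * C / (A * C + (B + C) * γ))
    (f : ℝ → ℝ → ℝ) (hf : ∀ x y : ℝ, f x y = (r + p * x + y) / (q * x + y))
    (ybar : ℝ)
    (hybar : ybar = (p + 1 + Real.sqrt ((p + 1) ^ 2 + 4 * r * (q + 1))) / (2 * (q + 1))) :
    (∀ y : ℕ → ℝ, L ≤ y 0 → L ≤ y 1 →
        (∀ n : ℕ, y (n + 2) = f (y (n + 1)) (y n)) →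
        Tendsto y atTop (nhds ybar)) ∨
    (∃ m M : ℝ, L < m ∧ m < M ∧
      (∀ x ∈ Icc m M, ∀ y ∈ Icc m M, f x y ∈ Icc m M) ∧
      (∀ y : ℕ → ℝ, L ≤ y 0 → L ≤ y 1 →
        (∀ n : ℕ, y (n + 2) = f (y (n + 1)) (y n)) →
        ∃ N : ℕ, ∀ n ≥ N, y n ∈ Icc m M) ∧
      ((∀ y ∈ Icc m M, StrictMonoOn (fun x => f x y) (Icc m M)) ∨
       (∀ y ∈ Icc m M, StrictAntiOn (fun x => f x y) (Icc m M))) ∧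
      ((∀ x ∈ Icc m M, StrictMonoOn (fun y => f x y) (Icc m M)) ∨
       (∀ x ∈ Icc m M, StrictAntiOn (fun y => f x y) (Icc m M)))) := by
  have hD : 0 < A * C + (B + C) * γ := by positivity
  have hq0 : 0 < q := by rw [hq]; positivity
  have hL0 : 0 < L := by rw [hL]; positivity
  have hL1 : L < 1 := by
    rw [hL, div_lt_one hD]
    have : 0 < (B + C) * γ := by positivity
    linarith
  have hp1 : L * q < p := by
    have e : p - L * q = (B + C) * β / (A * C + (B + C) * γ) := by
      rw [hp, hL, hq]
      field_simp
      ring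
    have : 0 < (B + C) * β / (A * C + (B + C) * γ) := by positivity
    linarith
  have hr1 : (q + 1) * L ^ 2 < r + (p + 1) * L := by
    have hD' : γ * (B + C) + A * C ≠ 0 := by positivity
    have e : r + (p + 1) * L - (q + 1) * L ^ 2 =
        C * (B + C) ^ 2 * α / (A * C + (B + C) * γ) ^ 2 := by
      rw [hp, hL, hq, hr, show γ * (B + C) + A * C = A * C + (B + C) * γ by ring]
      field_simp
      ring
    have : 0 < C * (B + C) ^ 2 * α / (A * C + (B + C) * γ) ^ 2 := by positivity
    linarith
  obtain rfl : f = ratMap p q r := funext₂ hf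
  rcases dichotomy hq0 hL0 hL1 hp1 hr1 with h | ⟨m, M, hm, hmM, hinv, hpair, hmono⟩
  · left
    intro y h0 h1 hrec
    obtain ⟨I, S, hIS, hev⟩ := exists_limitPair hq0 hL0 hL1 hp1 hr1 h0 h1 hrec
    obtain rfl := h I S hIS
    rw [hybar, ← hIS.eq_equilibrium hq0 hL0 hr1, Metric.tendsto_nhds]
    intro ε hε
    filter_upwards [hev (I - ε / 2) (I + ε / 2) (by linarith) (by linarith)] with n hn
    rw [Real.dist_eq, abs_lt]
    constructor <;> linarith [hn.1, hn.2]
  · right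
    refine ⟨m, M, hm, hmM, hinv, ?_, hmono⟩
    intro y h0 h1 hrec
    obtain ⟨I, S, hIS, hev⟩ := exists_limitPair hq0 hL0 hL1 hp1 hr1 h0 h1 hrec
    obtain ⟨hmI, hSM⟩ := hpair I S hIS
    exact eventually_atTop.1 (hev m M hmI hSM)
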